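/- Consider the saturated closed-loop map on ℝ² (Euclidean norm): f(Δx) = (A − BK)(sat(Δx + x*) − x*), where A, B, K are 2×2 real matrices, sat(z) = z/max(‖z‖,1), and ‖x*‖ < 1. If (A − BK)ᵀ(A − BK) − I is negative definite, then Δx = 0 is the unique fixed point of f, i.e., f(0) = 0 and any Δx ∈ ℝ² with f(Δx) = Δx satisfies Δx = 0. Equivalently, x* is the unique equilibrium of the saturated system. -/

import Mathlib

open scoped Matrix

/-- Radial saturation onto the unit ball does not increase the distance to points of the ball. -/
theorem norm_inv_max_smul_sub_le {E : Type*} [NormedAddCommGroup E] [InnerProductSpace ℝ E]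
    {x : E} (hx : ‖x‖ ≤ 1) (z : E) : ‖(max ‖z‖ 1)⁻¹ • z - x‖ ≤ ‖z - x‖ := by
  rcases le_total ‖z‖ 1 with hz | hz
  · simp [max_eq_right hz]
  rw [max_eq_left hz]
  have hz0 : 0 < ‖z‖ := one_pos.trans_le hz
  have hzz : ‖z‖⁻¹ * ‖z‖ = 1 := inv_mul_cancel₀ hz0.ne'
  have hinv : ‖z‖⁻¹ ≤ 1 := inv_le_one_of_one_le₀ hz
  have hinner : inner ℝ z x ≤ ‖z‖ :=
    (real_inner_le_norm z x).trans (mul_le_of_le_one_right hz0.le hx)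
  refine le_of_sq_le_sq ?_ (norm_nonneg _)
  rw [norm_sub_sq_real, norm_sub_sq_real, real_inner_smul_left, norm_smul, norm_inv, norm_norm, hzz]
  nlinarith [mul_le_mul_of_nonneg_left hinner (sub_nonneg.2 hinv), sq_nonneg (‖z‖ - 1)]

/-- If `Mᵀ M - I` is negative definite, then `M` strictly decreases the norm of nonzero vectors. -/
theorem norm_toEuclideanLin_lt {n : Type*} [Fintype n] [DecidableEq n] {M : Matrix n n ℝ}
    (hM : ∀ z : n → ℝ, z ≠ 0 → z ⬝ᵥ ((Mᵀ * M - 1).mulVec z) < 0)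
    {w : EuclideanSpace ℝ n} (hw : w ≠ 0) : ‖Matrix.toEuclideanLin M w‖ < ‖w‖ := by
  have h := hM w.ofLp (by simpa using hw)
  rw [Matrix.sub_mulVec, Matrix.one_mulVec, dotProduct_sub, ← Matrix.mulVec_mulVec,
    Matrix.dotProduct_mulVec, Matrix.vecMul_transpose, sub_neg] at h
  refine lt_of_pow_lt_pow_left₀ 2 (norm_nonneg _) ?_
  simpa [EuclideanSpace.real_norm_sq_eq, dotProduct, ← sq] using h

/-- Unique equilibrium: for the saturated closed-loop map
`f (Δx) = (A - B K) (sat (Δx + x*) - x*)` on Euclidean ℝ² with `‖x*‖ < 1` and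
`(A - B K)ᵀ (A - B K) - I ≺ 0`, the origin is the unique fixed point of `f`. -/
theorem saturated_closed_loop_unique_fixed_point
    (A B K : Matrix (Fin 2) (Fin 2) ℝ)
    (xstar : EuclideanSpace ℝ (Fin 2)) (hxstar : ‖xstar‖ < 1)
    (sat : EuclideanSpace ℝ (Fin 2) → EuclideanSpace ℝ (Fin 2))
    (hsat : ∀ z, sat z = (max ‖z‖ 1)⁻¹ • z)
    (hK : ∀ z : Fin 2 → ℝ, z ≠ 0 →
      z ⬝ᵥ (((A - B * K)ᵀ * (A - B * K) - 1).mulVec z) < 0)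
    (f : EuclideanSpace ℝ (Fin 2) → EuclideanSpace ℝ (Fin 2))
    (hf : ∀ Δx, f Δx = Matrix.toEuclideanLin (A - B * K) (sat (Δx + xstar) - xstar)) :
    f 0 = 0 ∧ ∀ Δx : EuclideanSpace ℝ (Fin 2), f Δx = Δx → Δx = 0 := by
  have hsat_xstar : sat xstar = xstar := by simp [hsat, max_eq_right hxstar.le]
  refine ⟨by simp [hf, hsat_xstar], fun Δx hfix => ?_⟩
  rw [hf] at hfix
  by_cases hw : sat (Δx + xstar) - xstar = 0
  · rw [← hfix, hw, map_zero]
  have hlt := norm_toEuclideanLin_lt hK hw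
  have hle := norm_inv_max_smul_sub_le hxstar.le (Δx + xstar)
  rw [← hsat, add_sub_cancel_right] at hle
  rw [hfix] at hlt
  exact absurd hle hlt.not_ge
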